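/- Let n, m be positive integers, let r ≥ 1, and let f₁, …, f_r : ℤ/nℤ → ℤ/nℤ and g₁, …, g_r : ℤ/mℤ → ℤ/mℤ be families of functions such that f_{t₁} − f_{t₂} is a bijection of ℤ/nℤ and g_{t₁} − g_{t₂} is a bijection of ℤ/mℤ for all t₁ ≠ t₂. Define q_t : ℤ/(nm)ℤ → ℤ/(nm)ℤ for t = 1, …, r by q_t(im + j) := f_t(i)·m + g_t(j), where each residue modulo nm is written uniquely as im + j with 0 ≤ i < n and 0 ≤ j < m. Then for all t₁ ≠ t₂ the function q_{t₁} − q_{t₂} : ℤ/(nm)ℤ → ℤ/(nm)ℤ is a bijection; i.e., q₁, …, q_r form a clique of size r in G_{nm}. -/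

import Mathlib

/-- Given `f : ℤ/nℤ → ℤ/nℤ` and `g : ℤ/mℤ → ℤ/mℤ`, the function
`q : ℤ/(nm)ℤ → ℤ/(nm)ℤ` sending the residue `i*m + j` (with `0 ≤ i < n`, `0 ≤ j < m`)
to `f(i)*m + g(j)`. -/
def productFun (n m : ℕ) (f : ZMod n → ZMod n) (g : ZMod m → ZMod m) :
    ZMod (n * m) → ZMod (n * m) :=
  fun x =>
    ((f ((x.val / m : ℕ) : ZMod n)).val : ZMod (n * m)) * (m : ZMod (n * m)) +
      ((g ((x.val % m : ℕ) : ZMod m)).val : ZMod (n * m))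

theorem ZMod.intCast_right_eq_of_mul_add_eq {n m : ℕ} {a a' b b' : ℤ}
    (h : ((a * m + b : ℤ) : ZMod (n * m)) = ((a' * m + b' : ℤ) : ZMod (n * m))) :
    (b : ZMod m) = (b' : ZMod m) := by
  have h' := congrArg (ZMod.castHom (dvd_mul_left m n) (ZMod m)) h
  rw [map_intCast, map_intCast] at h'
  simpa only [Int.cast_add, Int.cast_mul, Int.cast_natCast, ZMod.natCast_self,
    mul_zero, zero_add] using h'

theorem ZMod.intCast_left_eq_of_mul_eq {n m : ℕ} (hm : 0 < m) {a a' : ℤ}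
    (h : ((a * m : ℤ) : ZMod (n * m)) = ((a' * m : ℤ) : ZMod (n * m))) :
    (a : ZMod n) = (a' : ZMod n) := by
  rw [ZMod.intCast_eq_intCast_iff_dvd_sub] at h ⊢
  rw [← sub_mul, Nat.cast_mul] at h
  exact Int.dvd_of_mul_dvd_mul_right (by exact_mod_cast hm.ne') h

theorem ZMod.natCast_inj_of_lt {n a b : ℕ} (ha : a < n) (hb : b < n)
    (h : (a : ZMod n) = (b : ZMod n)) : a = b := by
  rw [← ZMod.val_cast_of_lt ha, ← ZMod.val_cast_of_lt hb, h]

theorem productFun_sub_productFun (n m : ℕ) (f f' : ZMod n → ZMod n) (g g' : ZMod m → ZMod m)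
    (x : ZMod (n * m)) :
    productFun n m f g x - productFun n m f' g' x =
      (((((f ((x.val / m : ℕ) : ZMod n)).val : ℤ) - (f' ((x.val / m : ℕ) : ZMod n)).val) * m +
        (((g ((x.val % m : ℕ) : ZMod m)).val : ℤ) - (g' ((x.val % m : ℕ) : ZMod m)).val) : ℤ) :
          ZMod (n * m)) := by
  simp only [productFun]
  push_cast
  ring

/-- If `f₁, …, f_r : ℤ/nℤ → ℤ/nℤ` pairwise differ by bijections and
`g₁, …, g_r : ℤ/mℤ → ℤ/mℤ` pairwise differ by bijections, then the functions
`q_t(i*m + j) := f_t(i)*m + g_t(j)` pairwise differ by bijections, i.e. they form a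
clique of size `r` in `G (n*m)`. -/
theorem productFun_clique (n m : ℕ) (hn : 0 < n) (hm : 0 < m) (r : ℕ) (hr : 1 ≤ r)
    (f : Fin r → ZMod n → ZMod n) (g : Fin r → ZMod m → ZMod m)
    (hf : ∀ t₁ t₂ : Fin r, t₁ ≠ t₂ →
      Function.Bijective (fun x : ZMod n => f t₁ x - f t₂ x))
    (hg : ∀ t₁ t₂ : Fin r, t₁ ≠ t₂ →
      Function.Bijective (fun x : ZMod m => g t₁ x - g t₂ x)) :
    ∀ t₁ t₂ : Fin r, t₁ ≠ t₂ →
      Function.Bijective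
        (fun x : ZMod (n * m) =>
          productFun n m (f t₁) (g t₁) x - productFun n m (f t₂) (g t₂) x) := by
  intro t₁ t₂ ht
  have : NeZero n := ⟨hn.ne'⟩
  have : NeZero m := ⟨hm.ne'⟩
  have : NeZero (n * m) := ⟨(Nat.mul_pos hn hm).ne'⟩
  refine Finite.injective_iff_bijective.mp fun x y hxy => ?_
  simp only [productFun_sub_productFun] at hxy
  have hmod : x.val % m = y.val % m := by
    have h := ZMod.intCast_right_eq_of_mul_add_eq hxy
    simp only [Int.cast_sub, Int.cast_natCast, ZMod.natCast_zmod_val] at h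
    exact ZMod.natCast_inj_of_lt (Nat.mod_lt _ hm) (Nat.mod_lt _ hm) ((hg t₁ t₂ ht).1 h)
  have hdiv : x.val / m = y.val / m := by
    rw [hmod, Int.cast_add, Int.cast_add, add_left_inj] at hxy
    have h := ZMod.intCast_left_eq_of_mul_eq hm hxy
    simp only [Int.cast_sub, Int.cast_natCast, ZMod.natCast_zmod_val] at h
    have hlt (z : ZMod (n * m)) : z.val / m < n :=
      Nat.div_lt_of_lt_mul (Nat.mul_comm n m ▸ z.val_lt)
    exact ZMod.natCast_inj_of_lt (hlt x) (hlt y) ((hf t₁ t₂ ht).1 h)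
  apply ZMod.val_injective (n * m)
  rw [← Nat.div_add_mod x.val m, ← Nat.div_add_mod y.val m, hdiv, hmod]
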